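/- Let I be a finite set and for each i ∈ I let E_i be a nonempty set. Let E = Π_{i ∈ I} E_i and let 𝔤 be the real vector space of all functions from E to ℝ. For a ⊆ I, let F(a) be the subspace of 𝔤 consisting of the functions f : E → ℝ that factor through the restriction map π_a : E → Π_{i ∈ a} E_i (i.e. there exists g : (Π_{i ∈ a} E_i) → ℝ with f = g ∘ π_a). Then the monotone map F : 𝒫(I) → Submodule ℝ 𝔤 (where 𝒫(I) is the powerset of I ordered by inclusion) is decomposable: there exists a family s : 𝒫(I) → Submodule ℝ 𝔤 which is independent (for every a ⊆ I, s a ⊓ (⨆_{b ⊆ I, b ≠ a} s b) = ⊥) and satisfies F(a) = ⨆_{b ⊆ a} s b for every a ⊆ I. -/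

import Mathlib

open Function

/-- The factor subspace `F a ≤ (E → ℝ)` of functions factoring through the
restriction map `π_a : (∀ i, E i) → (∀ i : a, E i)`. -/
def factorSubspace {I : Type*} (E : I → Type*) (a : Set I) :
    Submodule ℝ ((∀ i, E i) → ℝ) :=
  LinearMap.range (LinearMap.funLeft ℝ ℝ (fun (x : ∀ i, E i) (i : a) => x i.1))

/-- For a family `T` of endomorphisms, the simultaneous eigenspace on which `T i` vanishes for
`i ∈ a` and is the identity for `i ∉ a`. -/
noncomputable def interactionSubspace {I R M : Type*} [CommRing R] [AddCommGroup M] [Module R M]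
    (T : I → Module.End R M) (a : Set I) : Submodule R M :=
  ⨅ i, Module.End.eigenspace (T i) (aᶜ.indicator 1 i)

theorem mem_interactionSubspace {I R M : Type*} [CommRing R] [AddCommGroup M] [Module R M]
    {T : I → Module.End R M} {a : Set I} {f : M} :
    f ∈ interactionSubspace T a ↔ (∀ i ∈ a, T i f = 0) ∧ ∀ i ∉ a, T i f = f := by
  simp only [interactionSubspace, Submodule.mem_iInf, Module.End.mem_eigenspace_iff]
  refine ⟨fun h => ⟨fun i hi => ?_, fun i hi => ?_⟩, fun h i => ?_⟩
  · simpa [hi] using h i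
  · simpa [hi] using h i
  · by_cases hi : i ∈ a
    · simpa [hi] using h.1 i hi
    · simpa [hi] using h.2 i hi

theorem iSupIndep_interactionSubspace {I R M : Type*} [CommRing R] [IsDomain R] [AddCommGroup M]
    [Module R M] [Module.IsTorsionFree R M] {T : I → Module.End R M}
    (hT : ∀ i j, Commute (T i) (T j)) : iSupIndep (interactionSubspace T) := by
  have h := Module.End.independent_iInf_maxGenEigenspace_of_forall_mapsTo T
    fun i j φ => Module.End.mapsTo_maxGenEigenspace_of_comm (hT j i) φ
  have hinj : Function.Injective fun a : Set I => aᶜ.indicator (1 : I → R) := fun a b hab =>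
    compl_injective (Set.indicator_one_inj R hab)
  exact (h.comp hinj).mono fun a => iInf_mono fun i => Module.End.eigenspace_le_maxGenEigenspace

/-- If commuting idempotents `T i` vanish at `f` for `i ∈ a` and fix `f` for `i` outside `c ∪ a`,
then `f` is a sum of elements of the interaction subspaces indexed by subsets of `c ∪ a`. -/
theorem mem_iSup_interactionSubspace {I R M : Type*} [CommRing R] [AddCommGroup M] [Module R M]
    {T : I → Module.End R M} (hT : ∀ i j, Commute (T i) (T j))
    (hidem : ∀ i, IsIdempotentElem (T i)) {t : Set I} (c : Finset I) {a : Set I} {f : M}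
    (hct : (c : Set I) ⊆ t) (hat : a ⊆ t) (hvanish : ∀ i ∈ a, T i f = 0)
    (hfix : ∀ i ∉ c, i ∉ a → T i f = f) :
    f ∈ ⨆ b, ⨆ _ : b ≤ t, interactionSubspace T b := by
  classical
  have hcomm (i j : I) (g : M) : T i (T j g) = T j (T i g) := LinearMap.congr_fun (hT i j) g
  induction c using Finset.induction_on generalizing a f with
  | empty =>
    exact Submodule.mem_iSup_of_mem a (Submodule.mem_iSup_of_mem hat
      (mem_interactionSubspace.2 ⟨hvanish, fun i => hfix i (Finset.notMem_empty i)⟩))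
  | insert i c _ ih =>
    have hii : T i (T i f) = T i f := LinearMap.congr_fun (hidem i) f
    rw [Finset.coe_insert, Set.insert_subset_iff] at hct
    rw [← add_sub_cancel (T i f) f]
    refine add_mem (ih hct.2 hat (fun j hj => ?_) fun j hjc hja => ?_)
      (ih hct.2 (Set.insert_subset hct.1 hat) (fun j hj => ?_) fun j hjc hja => ?_)
    · rw [hcomm, hvanish j hj, map_zero]
    · by_cases hji : j = i
      · rw [hji, hii]
      · rw [hcomm, hfix j (by simp [hji, hjc]) hja]
    · rcases Set.mem_insert_iff.1 hj with rfl | hj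
      · rw [map_sub, hii, sub_self]
      · rw [map_sub, hcomm, hvanish j hj, map_zero, sub_zero]
    · rw [Set.mem_insert_iff, not_or] at hja
      rw [map_sub, hcomm, hfix j (by simp [hja.1, hjc]) hja.2]

/-- The operator freezing the `i`-th variable of a function at the value `o i`. -/
noncomputable def freeze {I : Type*} {E : I → Type*} [DecidableEq I] (o : ∀ i, E i) (i : I) :
    Module.End ℝ ((∀ i, E i) → ℝ) :=
  LinearMap.funLeft ℝ ℝ fun x => update x i (o i)

theorem freeze_apply {I : Type*} {E : I → Type*} [DecidableEq I] (o : ∀ i, E i) (i : I)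
    (f : (∀ i, E i) → ℝ) (x : ∀ i, E i) : freeze o i f x = f (update x i (o i)) :=
  rfl

theorem commute_freeze {I : Type*} {E : I → Type*} [DecidableEq I] (o : ∀ i, E i) (i j : I) :
    Commute (freeze o i) (freeze o j) := by
  refine LinearMap.ext fun f => funext fun x => ?_
  simp only [Module.End.mul_apply, freeze_apply]
  by_cases hij : i = j
  · rw [hij]
  · rw [update_comm hij]

theorem isIdempotentElem_freeze {I : Type*} {E : I → Type*} [DecidableEq I] (o : ∀ i, E i)
    (i : I) : IsIdempotentElem (freeze o i) := by
  refine LinearMap.ext fun f => funext fun x => ?_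
  simp only [Module.End.mul_apply, freeze_apply, update_idem]

theorem mem_factorSubspace_iff_freeze {I : Type*} [Finite I] {E : I → Type*} [DecidableEq I]
    (o : ∀ i, E i) {a : Set I} {f : (∀ i, E i) → ℝ} :
    f ∈ factorSubspace E a ↔ ∀ i ∉ a, freeze o i f = f := by
  classical
  constructor
  · rintro ⟨g, rfl⟩ i hi
    funext x
    simp only [freeze_apply, LinearMap.funLeft_apply]
    congr 1
    funext j
    exact update_of_ne (fun h : j.1 = i => hi (h ▸ j.2)) _ _
  · intro h
    have key (c : Finset I) (hc : ∀ i ∈ c, i ∉ a) (x : ∀ i, E i) : f (c.piecewise o x) = f x := by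
      induction c using Finset.induction_on with
      | empty => simp
      | insert i c _ ih =>
        rw [Finset.piecewise_insert, ← freeze_apply o i f, h i (hc i (Finset.mem_insert_self i c)),
          ih fun j hj => hc j (Finset.mem_insert_of_mem hj)]
    refine ⟨fun y => f fun i => if hi : i ∈ a then y ⟨i, hi⟩ else o i, funext fun x => ?_⟩
    rw [← key (Set.toFinite aᶜ).toFinset (by simp) x, LinearMap.funLeft_apply]
    congr 1
    funext i
    by_cases hi : i ∈ a <;> simp [hi, Finset.piecewise]

/-- For a finite set `I` and nonempty sets `E i`, the monotone map
`a ↦ F a` on the powerset of `I` is decomposable. -/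
theorem stmt_17 {I : Type*} [Finite I] (E : I → Type*) (hE : ∀ i, Nonempty (E i)) :
    ∃ s : Set I → Submodule ℝ ((∀ i, E i) → ℝ),
      (∀ a : Set I, s a ⊓ (⨆ b, ⨆ _ : b ≠ a, s b) = ⊥) ∧
      (∀ a : Set I, factorSubspace E a = ⨆ b, ⨆ _ : b ≤ a, s b) := by
  classical
  have o : ∀ i, E i := fun i => (hE i).some
  refine ⟨interactionSubspace (freeze o),
    fun a => (iSupIndep_interactionSubspace (commute_freeze o) a).eq_bot,
    fun a => le_antisymm (fun f hf => ?_) (iSup₂_le fun b hb f hf => ?_)⟩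
  · rw [mem_factorSubspace_iff_freeze o] at hf
    exact mem_iSup_interactionSubspace (commute_freeze o) (isIdempotentElem_freeze o)
      (Set.toFinite a).toFinset (by simp) (Set.empty_subset a) (by simp) (by simpa using hf)
  · exact (mem_factorSubspace_iff_freeze o).2 fun i hi =>
      (mem_interactionSubspace.1 hf).2 i fun hib => hi (hb hib)
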